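/- arXiv:2010.15641 — 3 statements merged into one kernel-verified Lean document; each statement's English description precedes it below -/
import Mathlib

section
/- There is a canonical bijection between the disjoint union ∐_{i=1}^n 𝒱_i and the set of equivalence classes of K̂-algebra embeddings L̂ → M̂^a, where two such embeddings are equivalent if and only if they differ by composition with an M̂-algebra automorphism of M̂^a. -/
open scoped TensorProduct

noncomputable section

/-- A sequence is Cauchy with respect to an absolute value. -/
def AbsCauchy {K : Type*} [Field K] (v : AbsoluteValue K ℝ) (s : ℕ → K) : Prop :=
  ∀ ε : ℝ, 0 < ε → ∃ N : ℕ, ∀ m ≥ N, ∀ n ≥ N, v (s m - s n) < ε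

/-- A sequence tends to a limit with respect to an absolute value. -/
def AbsTendsto {K : Type*} [Field K] (v : AbsoluteValue K ℝ) (s : ℕ → K) (a : K) : Prop :=
  ∀ ε : ℝ, 0 < ε → ∃ N : ℕ, ∀ n ≥ N, v (s n - a) < ε

/-- A field is complete with respect to an absolute value if every Cauchy sequence converges. -/
def AbsComplete {K : Type*} [Field K] (v : AbsoluteValue K ℝ) : Prop :=
  ∀ s : ℕ → K, AbsCauchy v s → ∃ a : K, AbsTendsto v s a

/-- The absolute value `vB` extends the absolute value `vA` along the embedding `f`. -/
def ExtendsAV {A B : Type*} [Field A] [Field B] (vA : AbsoluteValue A ℝ)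
    (vB : AbsoluteValue B ℝ) (f : A →+* B) : Prop :=
  ∀ x : A, vB (f x) = vA x

/-- `(B, vB, f)` is a completion of `(A, vA)`:  `f` is an isometric embedding with dense
image and `B` is complete. -/
structure IsCompletion {A B : Type*} [Field A] [Field B] (vA : AbsoluteValue A ℝ)
    (vB : AbsoluteValue B ℝ) (f : A →+* B) : Prop where
  extendsAV : ExtendsAV vA vB f
  complete : AbsComplete vB
  dense : ∀ y : B, ∀ ε : ℝ, 0 < ε → ∃ x : A, vB (y - f x) < ε

/-- Pullback of an absolute value along an embedding of fields. -/
def AbsoluteValue.comapRH {A B : Type*} [Field A] [Field B]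
    (v : AbsoluteValue B ℝ) (f : A →+* B) : AbsoluteValue A ℝ where
  toFun x := v (f x)
  map_mul' x y := by simp [map_mul]
  nonneg' x := v.nonneg _
  eq_zero' x := by
    rw [map_eq_zero, map_eq_zero]
  add_le' x y := by simpa using v.add_le (f x) (f y)

/-- If `a ^ n` is bounded by a linear multiple of `b ^ n` for all `n`, then `a ≤ b`. -/
theorem le_of_forall_pow_le {a b C : ℝ} (hb : 0 ≤ b)
    (h : ∀ n : ℕ, a ^ n ≤ C * ((n + 1) * b ^ n)) : a ≤ b := by
  by_contra! hab
  have ha' : 0 < a := hb.trans_lt hab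
  have hr : b / a < 1 := (div_lt_one ha').2 hab
  have hr0 : 0 ≤ b / a := by positivity
  have ht : Filter.Tendsto (fun n : ℕ => C * ((n : ℝ) * (b / a) ^ n + (b / a) ^ n))
      Filter.atTop (nhds (C * (0 + 0))) :=
    ((tendsto_self_mul_const_pow_of_lt_one hr0 hr).add
      (tendsto_pow_atTop_nhds_zero_of_lt_one hr0 hr)).const_mul C
  have h1 : (1 : ℝ) ≤ C * (0 + 0) := by
    refine ge_of_tendsto' ht fun n => ?_
    have := h n
    rw [div_pow]
    rw [show C * ((n : ℝ) * (b ^ n / a ^ n) + b ^ n / a ^ n) = C * ((n + 1) * b ^ n) / a ^ n by ring,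
      le_div_iff₀ (by positivity)]
    simpa using this
  norm_num at h1

theorem AbsComplete.completeSpace {K : Type*} [NormedField K] {v : AbsoluteValue K ℝ}
    (hv : ∀ x, v x = ‖x‖) (h : AbsComplete v) : CompleteSpace K := by
  refine Metric.complete_of_cauchySeq_tendsto fun u hu => ?_
  rw [Metric.cauchySeq_iff] at hu
  obtain ⟨a, ha⟩ := h u (by simpa only [AbsCauchy, hv, dist_eq_norm, gt_iff_lt, ge_iff_le] using hu)
  exact ⟨a, Metric.tendsto_atTop.2
    (by simpa only [AbsTendsto, hv, dist_eq_norm, gt_iff_lt, ge_iff_le] using ha)⟩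

theorem absComplete_of_completeSpace {K : Type*} [NormedField K] [CompleteSpace K]
    {v : AbsoluteValue K ℝ} (hv : ∀ x, v x = ‖x‖) : AbsComplete v := by
  intro s hs
  have hc : CauchySeq s := by
    rw [Metric.cauchySeq_iff]
    simpa only [AbsCauchy, hv, dist_eq_norm, gt_iff_lt, ge_iff_le] using hs
  obtain ⟨a, ha⟩ := cauchySeq_tendsto_of_complete hc
  refine ⟨a, ?_⟩
  simpa only [AbsTendsto, hv, dist_eq_norm, gt_iff_lt, ge_iff_le] using Metric.tendsto_atTop.1 ha

theorem exists_extend_ringHom_of_isometry {A B C : Type*} [NormedField A] [NormedField B]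
    [NormedField C] [CompleteSpace C] (f : A →+* B) (g : A →+* C)
    (hf : Isometry f) (hd : DenseRange f) (hg : Isometry g) :
    ∃ φ : B →+* C, (∀ x, φ (f x) = g x) ∧ ∀ y, ‖φ y‖ = ‖y‖ := by
  have hu := hf.isUniformInducing
  have hcont := (uniformContinuous_uniformly_extend hu hd hg.uniformContinuous).continuous
  have hext : ∀ x, IsDenseInducing.extendRingHom hu hd hg.uniformContinuous (f x) = g x :=
    fun x => IsDenseInducing.extend_eq (hu.isDenseInducing hd) hg.continuous x
  refine ⟨IsDenseInducing.extendRingHom hu hd hg.uniformContinuous, hext, fun y => ?_⟩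
  refine DenseRange.induction_on hd y (isClosed_eq hcont.norm continuous_norm) fun x => ?_
  rw [hext, hf.norm_map_of_map_zero (map_zero f), hg.norm_map_of_map_zero (map_zero g)]

/-- An embedding into a complete field preserving absolute values extends to the completion. -/
theorem IsCompletion.exists_extend {A B C : Type*} [Field A] [Field B] [Field C]
    {vA : AbsoluteValue A ℝ} {vB : AbsoluteValue B ℝ} {vC : AbsoluteValue C ℝ} {f : A →+* B}
    (hf : IsCompletion vA vB f) (hC : AbsComplete vC) {g : A →+* C} (hg : ExtendsAV vA vC g) :
    ∃ φ : B →+* C, (∀ x, φ (f x) = g x) ∧ ExtendsAV vB vC φ := by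
  let := vA.toNormedField
  let := vB.toNormedField
  let := vC.toNormedField
  have := hC.completeSpace fun _ => rfl
  exact exists_extend_ringHom_of_isometry f g (AddMonoidHomClass.isometry_of_norm f hf.extendsAV)
    (Metric.denseRange_iff.2 fun y r hr => by simpa only [dist_eq_norm] using! hf.dense y r hr)
    (AddMonoidHomClass.isometry_of_norm g hg)

theorem AbsoluteValue.exists_isCompletion.{u} {A : Type u} [Field A] (v : AbsoluteValue A ℝ) :
    ∃ (C : Type u) (_ : Field C) (w : AbsoluteValue C ℝ) (f : A →+* C), IsCompletion v w f := by
  let := v.toNormedField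
  refine ⟨UniformSpace.Completion A, inferInstance, NormedField.toAbsoluteValue _,
    UniformSpace.Completion.coeRingHom, ?_, absComplete_of_completeSpace fun _ => rfl, ?_⟩
  · exact fun x => UniformSpace.Completion.norm_coe x
  · intro y ε hε
    obtain ⟨x, hx⟩ := Metric.denseRange_iff.1 UniformSpace.Completion.denseRange_coe y ε hε
    exact ⟨x, by rw [dist_eq_norm] at hx; exact hx⟩

/-- Two ring homomorphisms out of a completion that preserve absolute values and agree on the
dense subfield are equal. -/
theorem IsCompletion.hom_ext {A B C : Type*} [Field A] [Field B] [Field C]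
    {vA : AbsoluteValue A ℝ} {vB : AbsoluteValue B ℝ} {vC : AbsoluteValue C ℝ} {f : A →+* B}
    (hf : IsCompletion vA vB f) {g h : B →+* C} (hg : ExtendsAV vB vC g) (hh : ExtendsAV vB vC h)
    (hgh : ∀ x, g (f x) = h (f x)) (y : B) : g y = h y := by
  rw [← sub_eq_zero, ← vC.eq_zero]
  refine le_antisymm (le_of_forall_pos_lt_add fun ε hε => ?_) (vC.nonneg _)
  obtain ⟨x, hx⟩ := hf.dense y (ε / 2) (half_pos hε)
  have h1 := vC.add_le (g (y - f x)) (-h (y - f x))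
  rw [vC.map_neg, hg, hh] at h1
  have h2 : g y - h y = g (y - f x) + -h (y - f x) := by
    rw [map_sub, map_sub, hgh]; ring
  rw [h2]
  linarith

theorem AbsoluteValue.le_sum_repr {E E' ι : Type*} [Fintype ι] [Field E] [Field E']
    [Algebra E E'] {v : AbsoluteValue E ℝ} {w : AbsoluteValue E' ℝ}
    (hw : ExtendsAV v w (algebraMap E E')) {S : Submodule E E'} (b : Module.Basis ι E S) (y : S) :
    w y ≤ ∑ i, v (b.repr y i) * w (b i) := by
  conv_lhs => rw [← b.sum_repr y]
  rw [AddSubmonoidClass.coe_finsetSum]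
  refine (w.sum_le _ _).trans (Finset.sum_le_sum fun i _ => ?_)
  rw [Submodule.coe_smul, Algebra.smul_def, map_mul, hw]

/-- Extensions of the trivial absolute value to an algebraic extension are trivial. -/
theorem AbsoluteValue.eq_one_of_not_isNontrivial {E E' : Type*} [Field E] [Field E']
    [Algebra E E'] {v : AbsoluteValue E ℝ} (hv : ¬ v.IsNontrivial) {w : AbsoluteValue E' ℝ}
    (hw : ExtendsAV v w (algebraMap E E')) [Algebra.IsAlgebraic E E'] {x : E'} (hx : x ≠ 0) :
    w x = 1 := by
  have key : ∀ x : E', w x ≤ 1 := by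
    intro x
    have hxi : IsIntegral E x := Algebra.IsIntegral.isIntegral x
    have : FiniteDimensional E (Subalgebra.toSubmodule (Algebra.adjoin E {x})) :=
      .of_fg hxi.fg_adjoin_singleton
    let b := Module.finBasis E (Subalgebra.toSubmodule (Algebra.adjoin E {x}))
    refine le_of_forall_pow_le (C := ∑ i, w (b i)) zero_le_one fun n => ?_
    have hn := le_sum_repr hw b ⟨x ^ n, pow_mem (Algebra.self_mem_adjoin_singleton E x) n⟩
    have hv1 : ∀ a, v a ≤ 1 := fun a => by
      rcases eq_or_ne a 0 with rfl | ha
      · simp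
      · exact (not_isNontrivial_apply hv ha).le
    have h0 : 0 ≤ ∑ i, w (b i) := Finset.sum_nonneg fun i _ => w.nonneg _
    calc w x ^ n = w (x ^ n) := (map_pow w x n).symm
      _ ≤ _ := hn
      _ ≤ ∑ i, w (b i) :=
        Finset.sum_le_sum fun i _ => mul_le_of_le_one_left (w.nonneg _) (hv1 _)
      _ ≤ _ := by
        rw [one_pow, mul_one]
        exact le_mul_of_one_le_right h0 (by simp)
  refine le_antisymm (key x) ?_
  have := key x⁻¹
  rw [map_inv₀] at this
  exact (inv_le_one₀ (w.pos hx)).1 this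

theorem AbsoluteValue.le_norm_of_extends {E E' : Type*} [NontriviallyNormedField E]
    [CompleteSpace E] [NormedField E'] [NormedAlgebra E E'] {v : AbsoluteValue E ℝ}
    (hv : ∀ x, v x = ‖x‖) {w : AbsoluteValue E' ℝ} (hw : ExtendsAV v w (algebraMap E E'))
    {x : E'} (hx : IsIntegral E x) : w x ≤ ‖x‖ := by
  let S := Subalgebra.toSubmodule (Algebra.adjoin E {x})
  have : FiniteDimensional E S := .of_fg hx.fg_adjoin_singleton
  let b := Module.finBasis E S
  let c := fun i => LinearMap.toContinuousLinearMap (b.coord i)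
  refine le_of_forall_pow_le (C := ∑ i, ‖c i‖ * w (b i)) (norm_nonneg x) fun n => ?_
  let y : S := ⟨x ^ n, pow_mem (Algebra.self_mem_adjoin_singleton E x) n⟩
  have h0 : 0 ≤ ∑ i, ‖c i‖ * w (b i) :=
    Finset.sum_nonneg fun i _ => mul_nonneg (ContinuousLinearMap.opNorm_nonneg _) (w.nonneg _)
  calc w x ^ n = w y := (map_pow w x n).symm
    _ ≤ _ := le_sum_repr hw b y
    _ ≤ ∑ i, (‖c i‖ * w (b i)) * ‖x‖ ^ n := by
      refine Finset.sum_le_sum fun i _ => ?_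
      have h1 : v (b.repr y i) ≤ ‖c i‖ * ‖x‖ ^ n := by
        rw [hv, ← norm_pow]
        exact (c i).le_opNorm y
      calc _ ≤ (‖c i‖ * ‖x‖ ^ n) * w (b i) := mul_le_mul_of_nonneg_right h1 (w.nonneg _)
        _ = _ := by ring
    _ = (∑ i, ‖c i‖ * w (b i)) * ‖x‖ ^ n := by rw [Finset.sum_mul]
    _ ≤ _ := by
      refine mul_le_mul_of_nonneg_left ?_ h0
      exact le_mul_of_one_le_left (by positivity) (by simp)

/-- The nontrivially normed field structure given by a nontrivial absolute value. -/
@[reducible]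
def AbsoluteValue.toNontriviallyNormedField {E : Type*} [Field E] (v : AbsoluteValue E ℝ)
    (hv : v.IsNontrivial) : NontriviallyNormedField E :=
  { v.toNormedField with non_trivial := hv.exists_abv_gt_one }

theorem AbsoluteValue.le_of_extends {E E' : Type*} [Field E] [Field E']
    [Algebra E E'] [Algebra.IsAlgebraic E E'] {v : AbsoluteValue E ℝ} (hc : AbsComplete v)
    {w₁ w₂ : AbsoluteValue E' ℝ} (h₁ : ExtendsAV v w₁ (algebraMap E E'))
    (h₂ : ExtendsAV v w₂ (algebraMap E E')) (x : E') : w₁ x ≤ w₂ x := by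
  by_cases hv : v.IsNontrivial
  · let := v.toNontriviallyNormedField hv
    let := w₂.toNormedField
    let : NormedAlgebra E E' :=
      { (inferInstance : Algebra E E') with
        norm_smul_le := fun r x => by
          rw [Algebra.smul_def]
          exact ((map_mul w₂ _ _).trans (by rw [h₂]; rfl)).le }
    have : CompleteSpace E := hc.completeSpace fun _ => rfl
    exact le_norm_of_extends (v := v) (fun _ => rfl) h₁ (Algebra.IsIntegral.isIntegral x)
  · rcases eq_or_ne x 0 with rfl | hx
    · simp
    · rw [eq_one_of_not_isNontrivial hv h₁ hx, eq_one_of_not_isNontrivial hv h₂ hx]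

/-- An absolute value on a complete field extends in at most one way to an algebraic extension. -/
theorem AbsoluteValue.eq_of_extends {E E' : Type*} [Field E] [Field E']
    [Algebra E E'] [Algebra.IsAlgebraic E E'] {v : AbsoluteValue E ℝ} (hc : AbsComplete v)
    {w₁ w₂ : AbsoluteValue E' ℝ} (h₁ : ExtendsAV v w₁ (algebraMap E E'))
    (h₂ : ExtendsAV v w₂ (algebraMap E E')) (x : E') : w₁ x = w₂ x :=
  (le_of_extends hc h₁ h₂ x).antisymm (le_of_extends hc h₂ h₁ x)

/-- If a real power of an absolute value is the identity on the natural numbers, then that power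
satisfies the triangle inequality. -/
theorem AbsoluteValue.rpow_add_le {F : Type*} [Field F] {v : AbsoluteValue F ℝ} {c : ℝ}
    (hc : 0 < c) (hv : ∀ n : ℕ, v n ^ c = n) (x y : F) :
    v (x + y) ^ c ≤ v x ^ c + v y ^ c := by
  set B : ℝ := v x ^ c + v y ^ c with hB
  have hx := Real.rpow_nonneg (v.nonneg x) c
  have hy := Real.rpow_nonneg (v.nonneg y) c
  have hB0 : 0 ≤ B := add_nonneg hx hy
  suffices h : v (x + y) ≤ B ^ c⁻¹ from
    (Real.le_rpow_inv_iff_of_pos (v.nonneg _) hB0 hc).1 h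
  refine le_of_forall_pow_le (C := 1) (Real.rpow_nonneg hB0 _) fun n => ?_
  rw [← map_pow, add_pow, one_mul]
  refine (v.sum_le _ _).trans ?_
  have hterm : ∀ i ∈ Finset.range (n + 1),
      v (x ^ i * y ^ (n - i) * (n.choose i : F)) ≤ (B ^ c⁻¹) ^ n := by
    intro i hi
    have h1 : (B ^ c⁻¹) ^ n = (B ^ n) ^ c⁻¹ := by
      rw [← Real.rpow_natCast, ← Real.rpow_natCast, ← Real.rpow_mul hB0, ← Real.rpow_mul hB0,
        mul_comm]
    rw [h1, Real.le_rpow_inv_iff_of_pos (v.nonneg _) (by positivity) hc, map_mul, map_mul,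
      Real.mul_rpow (by positivity) (by positivity), Real.mul_rpow (by positivity) (by positivity),
      hv, map_pow, map_pow, ← Real.rpow_pow_comm (v.nonneg _), ← Real.rpow_pow_comm (v.nonneg _),
      hB, add_pow]
    exact Finset.single_le_sum
      (f := fun i => (v x ^ c) ^ i * (v y ^ c) ^ (n - i) * (n.choose i : ℝ))
      (fun i _ => by positivity) hi
  refine (Finset.sum_le_sum hterm).trans ?_
  simp

/-- The `c`-th power of an absolute value, when it satisfies the triangle inequality. -/
def AbsoluteValue.rpow {F : Type*} [Field F] (v : AbsoluteValue F ℝ) {c : ℝ} (hc : 0 < c)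
    (h : ∀ x y, v (x + y) ^ c ≤ v x ^ c + v y ^ c) : AbsoluteValue F ℝ where
  toFun x := v x ^ c
  map_mul' x y := by rw [map_mul, Real.mul_rpow (v.nonneg _) (v.nonneg _)]
  nonneg' x := Real.rpow_nonneg (v.nonneg _) _
  eq_zero' x := by
    rw [Real.rpow_eq_zero (v.nonneg _) hc.ne', v.eq_zero]
  add_le' := h

theorem AbsComplete.of_rpow {F : Type*} [Field F] {v w : AbsoluteValue F ℝ} {c : ℝ} (hc : 0 < c)
    (h : ∀ x, w x = v x ^ c) (hv : AbsComplete v) : AbsComplete w := by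
  intro s hs
  obtain ⟨a, ha⟩ := hv s fun ε hε => by
    obtain ⟨N, hN⟩ := hs (ε ^ c) (by positivity)
    refine ⟨N, fun m hm n hn => ?_⟩
    have := hN m hm n hn
    rwa [h, Real.rpow_lt_rpow_iff (v.nonneg _) hε.le hc] at this
  refine ⟨a, fun ε hε => ?_⟩
  obtain ⟨N, hN⟩ := ha (ε ^ c⁻¹) (by positivity)
  refine ⟨N, fun n hn => ?_⟩
  rw [h, ← Real.lt_rpow_inv_iff_of_pos (v.nonneg _) hε.le hc]
  exact hN n hn

theorem isCompletion_rat_real :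
    IsCompletion Rat.AbsoluteValue.real (AbsoluteValue.abs : AbsoluteValue ℝ ℝ)
      (Rat.castHom ℝ) where
  extendsAV _ := rfl
  complete := absComplete_of_completeSpace fun _ => rfl
  dense y ε hε := by
    obtain ⟨x, hx⟩ := Metric.denseRange_iff.1 Rat.denseRange_cast y ε hε
    exact ⟨x, by rw [dist_eq_norm] at hx; exact hx⟩

theorem AbsoluteValue.charZero_of_one_lt {F : Type*} [Field F] (v : AbsoluteValue F ℝ) {n : ℕ}
    (hn : 1 < v n) : CharZero F := by
  obtain ⟨p, hp⟩ := CharP.exists F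
  rcases CharP.char_is_prime_or_zero F p with hpp | rfl
  · have := Fact.mk hpp
    have h1 : (n : F) ^ p = n := by rw [← frobenius_def, map_natCast]
    have h2 : v n ^ p = v n := by rw [← map_pow, h1]
    have h3 : v n ^ 1 < v n ^ p := pow_lt_pow_right₀ hn hpp.one_lt
    rw [pow_one, h2] at h3
    exact absurd h3 (lt_irrefl _)
  · exact CharP.charP_to_charZero F

theorem AbsoluteValue.exists_extension_of_forall_natCast_le_one {F Fa : Type*} [Field F] [Field Fa]
    [Algebra F Fa] [Algebra.IsAlgebraic F Fa] {v : AbsoluteValue F ℝ} (hv : AbsComplete v)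
    (hn : ∀ n : ℕ, v n ≤ 1) : ∃ w : AbsoluteValue Fa ℝ, ExtendsAV v w (algebraMap F Fa) := by
  classical
  by_cases hnt : v.IsNontrivial
  · let := v.toNontriviallyNormedField hnt
    have : CompleteSpace F := hv.completeSpace fun _ => rfl
    have : IsUltrametricDist F :=
      IsUltrametricDist.isUltrametricDist_of_forall_norm_natCast_le_one hn
    let := spectralNorm.normedField F Fa
    refine ⟨NormedField.toAbsoluteValue Fa, fun x => ?_⟩
    exact spectralNorm_extends x
  · refine ⟨.trivial, fun x => ?_⟩
    rcases eq_or_ne x 0 with rfl | hx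
    · simp
    · rw [not_isNontrivial_apply hnt hx, trivial_apply (by simpa using hx)]

theorem AbsoluteValue.exists_extension_of_one_lt_natCast {F Fa : Type*} [Field F] [Field Fa]
    [Algebra F Fa] [IsAlgClosure F Fa] {v : AbsoluteValue F ℝ} (hv : AbsComplete v)
    {n : ℕ} (hn : 1 < v n) : ∃ w : AbsoluteValue Fa ℝ, ExtendsAV v w (algebraMap F Fa) := by
  have := v.charZero_of_one_lt hn
  have heq : (v.comapRH (algebraMap ℚ F)).IsEquiv Rat.AbsoluteValue.real := by
    refine Rat.AbsoluteValue.equiv_real_of_unbounded fun h => ?_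
    have := h n
    simp only [comapRH, coe_mk, MulHom.coe_mk, map_natCast] at this
    exact absurd hn this.not_gt
  obtain ⟨c, hc, hcv⟩ := isEquiv_iff_exists_rpow_eq.1 heq
  have hq : ∀ q : ℚ, v (algebraMap ℚ F q) ^ c = |(q : ℝ)| := fun q => by
    have := congrFun hcv q
    simpa [comapRH] using this
  have hnat : ∀ n : ℕ, v n ^ c = n := fun n => by simpa using hq n
  have hc1 : 1 ≤ c := by
    have h2 : v 2 ≤ 2 := by
      have := v.add_le 1 1
      rw [map_one] at this
      norm_num at this
      exact this
    have h3 : (2 : ℝ) ≤ 2 ^ c := by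
      calc (2 : ℝ) = v 2 ^ c := by simpa using (hnat 2).symm
        _ ≤ _ := Real.rpow_le_rpow (v.nonneg _) h2 hc.le
    by_contra! h
    have := Real.rpow_lt_rpow_of_exponent_lt (x := 2) one_lt_two h
    rw [Real.rpow_one] at this
    linarith
  let u := v.rpow hc (rpow_add_le hc hnat)
  have hu : AbsComplete u := hv.of_rpow hc fun _ => rfl
  obtain ⟨g, -, hg⟩ := isCompletion_rat_real.exists_extend hu (g := algebraMap ℚ F) hq
  obtain ⟨w, hw⟩ : ∃ w : AbsoluteValue Fa ℝ, ExtendsAV u w (algebraMap F Fa) := by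
    let := u.toNormedField
    let : NormedAlgebra ℝ F :=
      { g.toAlgebra with
        norm_smul_le := fun r x =>
          ((map_mul u (g r) x).trans (by rw [hg]; rfl)).le }
    have : Algebra.IsAlgebraic ℝ F := by
      rcases NormedAlgebra.Real.nonempty_algEquiv_or F with ⟨⟨e⟩⟩ | ⟨⟨e⟩⟩
      · exact e.symm.isAlgebraic
      · exact e.symm.isAlgebraic
    let : Algebra ℝ Fa := ((algebraMap F Fa).comp (algebraMap ℝ F)).toAlgebra
    have : IsScalarTower ℝ F Fa := .of_algebraMap_eq' rfl
    have := IsAlgClosure.isAlgebraic (R := F) (K := Fa)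
    have := IsAlgClosure.isAlgClosed F (K := Fa)
    have : Algebra.IsAlgebraic ℝ Fa := .trans ℝ F Fa
    have : IsAlgClosure ℝ Fa := ⟨inferInstance, inferInstance⟩
    have : IsAlgClosure ℝ ℂ := ⟨inferInstance, inferInstance⟩
    let σ := IsAlgClosure.equiv ℝ Fa ℂ
    let w := (NormedField.toAbsoluteValue ℂ).comapRH (σ : Fa →+* ℂ)
    refine ⟨w, fun x => ?_⟩
    refine eq_of_extends (E := ℝ) isCompletion_rat_real.complete
      (w₁ := w.comapRH (algebraMap F Fa)) (w₂ := u) (fun r => ?_) hg x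
    change ‖σ (algebraMap ℝ Fa r)‖ = |r|
    simp
  have hci : 0 < c⁻¹ := inv_pos.2 hc
  refine ⟨w.rpow hci fun x y => ?_, fun x => ?_⟩
  · exact (Real.rpow_le_rpow (w.nonneg _) (w.add_le x y) hci.le).trans
      (Real.rpow_add_le_add_rpow (w.nonneg _) (w.nonneg _) hci.le (inv_le_one_of_one_le₀ hc1))
  · change w (algebraMap F Fa x) ^ c⁻¹ = v x
    rw [hw]
    exact Real.rpow_rpow_inv (v.nonneg x) hc.ne'

/-- An absolute value on a complete field extends to its algebraic closure. -/
theorem AbsoluteValue.exists_extension {F : Type*} (Fa : Type*) [Field F] [Field Fa]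
    [Algebra F Fa] [IsAlgClosure F Fa] {v : AbsoluteValue F ℝ} (hv : AbsComplete v) :
    ∃ w : AbsoluteValue Fa ℝ, ExtendsAV v w (algebraMap F Fa) := by
  by_cases h : ∀ n : ℕ, v n ≤ 1
  · have := IsAlgClosure.isAlgebraic (R := F) (K := Fa)
    exact exists_extension_of_forall_natCast_le_one hv h
  · push Not at h
    obtain ⟨n, hn⟩ := h
    exact exists_extension_of_one_lt_natCast hv hn

/-- If `L/K` is finite, then the completion of `L` is algebraic over the completion of `K`. -/
theorem IsCompletion.isAlgebraic {K L Kh Lh : Type*} [Field K] [Field L] [Field Kh] [Field Lh]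
    [Algebra K L] [Algebra K Kh] [Algebra L Lh] [Algebra Kh Lh] [Algebra K Lh]
    [IsScalarTower K Kh Lh] [IsScalarTower K L Lh] [FiniteDimensional K L]
    {vL : AbsoluteValue L ℝ} {vKh : AbsoluteValue Kh ℝ} {vLh : AbsoluteValue Lh ℝ}
    (hKh : AbsComplete vKh) (hLh : IsCompletion vL vLh (algebraMap L Lh))
    (hKhLh : ExtendsAV vKh vLh (algebraMap Kh Lh)) : Algebra.IsAlgebraic Kh Lh := by
  have hint : ∀ x : L, IsIntegral Kh (algebraMap L Lh x) := fun x =>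
    ((Algebra.IsIntegral.isIntegral (R := K) x).map (IsScalarTower.toAlgHom K L Lh)).tower_top
  by_cases hv : vKh.IsNontrivial
  · let S : Submodule Kh Lh :=
      Submodule.span Kh (Set.range fun i => algebraMap L Lh (Module.finBasis K L i))
    have hS : FiniteDimensional Kh S := FiniteDimensional.span_of_finite Kh (Set.finite_range _)
    have hL : ∀ x : L, algebraMap L Lh x ∈ S := by
      intro x
      rw [← (Module.finBasis K L).sum_repr x, map_sum]
      refine Submodule.sum_mem _ fun i _ => ?_
      rw [Algebra.smul_def, map_mul, ← IsScalarTower.algebraMap_apply K L Lh,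
        IsScalarTower.algebraMap_apply K Kh Lh, ← Algebra.smul_def]
      exact S.smul_mem _ (Submodule.subset_span ⟨i, rfl⟩)
    have htop : S = ⊤ := by
      let := vKh.toNontriviallyNormedField hv
      let := vLh.toNormedField
      let : NormedAlgebra Kh Lh :=
        { (inferInstance : Algebra Kh Lh) with
          norm_smul_le := fun r x => by
            rw [Algebra.smul_def]
            exact ((map_mul vLh _ _).trans (by rw [hKhLh]; rfl)).le }
      have : CompleteSpace Kh := hKh.completeSpace fun _ => rfl
      have hcl := S.closed_of_finiteDimensional
      refine eq_top_iff.2 fun y _ => ?_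
      rw [← SetLike.mem_coe, ← hcl.closure_eq, Metric.mem_closure_iff]
      intro ε hε
      obtain ⟨x, hx⟩ := hLh.dense y ε hε
      exact ⟨_, hL x, by rw [dist_eq_norm]; exact hx⟩
    have : FiniteDimensional Kh Lh := by
      rw [htop] at hS
      exact Module.Finite.equiv Submodule.topEquiv
    infer_instance
  · let A := algebraicClosure Kh Lh
    let w := vLh.comapRH (algebraMap A Lh)
    have hw : ExtendsAV vKh w (algebraMap Kh A) := hKhLh
    refine ⟨fun y => ?_⟩
    obtain ⟨x, hx⟩ := hLh.dense y (1 / 2) (by norm_num)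
    suffices h : y - algebraMap L Lh x = 0 by
      rw [sub_eq_zero.1 h]
      exact (hint x).isAlgebraic
    by_contra hne
    obtain ⟨x', hx'⟩ := hLh.dense (y - algebraMap L Lh x) (vLh (y - algebraMap L Lh x))
      (vLh.pos hne)
    have h1 : x' ≠ 0 := by
      rintro rfl
      simp at hx'
    have h2 : vLh (algebraMap L Lh x') = 1 :=
      AbsoluteValue.eq_one_of_not_isNontrivial hv hw
        (x := ⟨algebraMap L Lh x', (mem_algebraicClosure_iff).2 (hint x').isAlgebraic⟩)
        (by simpa [Subtype.ext_iff] using h1)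
    have h3 := vLh.add_le (y - algebraMap L Lh x) (-(y - algebraMap L Lh x - algebraMap L Lh x'))
    rw [vLh.map_neg, show y - algebraMap L Lh x + -(y - algebraMap L Lh x - algebraMap L Lh x')
      = algebraMap L Lh x' by ring, h2] at h3
    linarith

/-- Two algebra homomorphisms into an algebraic closure with the same kernel are conjugate. -/
theorem IsAlgClosure.exists_algEquiv_of_ker_eq {R T Ω : Type*} [Field R] [CommRing T] [Algebra R T]
    [Field Ω] [Algebra R Ω] [IsAlgClosure R Ω] {f g : T →ₐ[R] Ω}
    (h : ∀ t, f t = 0 ↔ g t = 0) : ∃ τ : Ω ≃ₐ[R] Ω, ∀ t, g t = τ (f t) := by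
  have := IsAlgClosure.isAlgebraic (R := R) (K := Ω)
  have := IsAlgClosure.isAlgClosed R (K := Ω)
  let A : IntermediateField R Ω :=
    Subalgebra.IsAlgebraic.toIntermediateField (S := f.range)
      fun x _ => Algebra.IsAlgebraic.isAlgebraic x
  let q : (T ⧸ RingHom.ker f.rangeRestrict) ≃ₐ[R] f.range :=
    Ideal.quotientKerAlgEquivOfSurjective f.rangeRestrict_surjective
  let l : (T ⧸ RingHom.ker f.rangeRestrict) →ₐ[R] Ω :=
    Ideal.Quotient.liftₐ _ g fun t ht => by
      rw [RingHom.mem_ker, Subtype.ext_iff] at ht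
      exact (h t).1 ht
  let φ : A →ₐ[R] Ω := l.comp q.symm.toAlgHom
  have hφ : ∀ t, φ ⟨f t, t, rfl⟩ = g t := fun t => by
    have : q.symm ⟨f t, t, rfl⟩ = Ideal.Quotient.mk _ t := by
      rw [AlgEquiv.symm_apply_eq]
      rfl
    exact congrArg l this
  obtain ⟨τ, hτ⟩ := IntermediateField.exists_algHom_of_splits
    (fun x => ⟨Algebra.IsIntegral.isIntegral x, IsAlgClosed.splits _⟩) φ
  refine ⟨AlgEquiv.ofBijective τ (Algebra.IsAlgebraic.algHom_bijective τ), fun t => ?_⟩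
  rw [← hφ, ← hτ]
  rfl

/-- A ring homomorphism from a finite product of fields to a field factors through a projection. -/
theorem RingHom.exists_eq_comp_eval {n : ℕ} {F : Fin n → Type*} [∀ i, Field (F i)] {Ω : Type*}
    [Field Ω] (β : ((i : Fin n) → F i) →+* Ω) :
    ∃ i, ∃ f : F i →+* Ω, ∀ x, β x = f (x i) := by
  obtain ⟨i, hi⟩ : ∃ i, β (Pi.single i 1) ≠ 0 := by
    by_contra! h
    have h1 : β 1 = 0 := by
      rw [← Finset.univ_sum_single (1 : (i : Fin n) → F i), map_sum]
      exact Finset.sum_eq_zero fun i _ => h i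
    exact one_ne_zero ((map_one β).symm.trans h1)
  have h1 : β (Pi.single i 1) = 1 := by
    refine mul_left_cancel₀ hi ?_
    rw [← map_mul, ← Pi.single_mul, mul_one, mul_one]
  refine ⟨i, { toFun := fun a => β (Pi.single i a)
               map_one' := h1
               map_mul' := fun a b => by rw [Pi.single_mul, map_mul]
               map_zero' := by rw [Pi.single_zero, map_zero]
               map_add' := fun a b => by rw [Pi.single_add, map_add] }, fun x => ?_⟩
  calc β x = β (x * Pi.single i 1) := by rw [map_mul, h1, mul_one]
    _ = β (Pi.single i (x i)) := by
      congr 1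
      ext j
      rcases eq_or_ne j i with rfl | hj
      · simp
      · simp [hj]

section TensorDecomposition

variable {K L M : Type*} [Field K] [Field L] [Field M] [Algebra K L] [Algebra K M]
  {n : ℕ} {F : Fin n → Type*} [∀ i, Field (F i)]
  [∀ i, Algebra K (F i)] [∀ i, Algebra L (F i)] [∀ i, Algebra M (F i)]
  {e : (L ⊗[K] M) ≃ₐ[K] ((i : Fin n) → F i)}

/-- Compatible embeddings of `L` and `M` into a field factor through one of the factors of
`L ⊗[K] M`. -/
theorem exists_factor_hom
    (he : ∀ (i : Fin n) (l : L) (m : M),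
      e (l ⊗ₜ[K] m) i = algebraMap L (F i) l * algebraMap M (F i) m)
    {Ω : Type*} [Field Ω] {a : L →+* Ω} {b : M →+* Ω}
    (hab : ∀ k : K, a (algebraMap K L k) = b (algebraMap K M k)) :
    ∃ i, ∃ f : F i →+* Ω, (∀ l, f (algebraMap L (F i) l) = a l) ∧
      ∀ m, f (algebraMap M (F i) m) = b m := by
  let : Algebra K Ω := (a.comp (algebraMap K L)).toAlgebra
  let a' : L →ₐ[K] Ω := { a with commutes' := fun _ => rfl }
  let b' : M →ₐ[K] Ω := { b with commutes' := fun k => (hab k).symm }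
  let β : (L ⊗[K] M) →ₐ[K] Ω := Algebra.TensorProduct.productMap a' b'
  obtain ⟨i, f, hf⟩ := RingHom.exists_eq_comp_eval
    ((β : (L ⊗[K] M) →+* Ω).comp (e.symm : ((i : Fin n) → F i) →+* (L ⊗[K] M)))
  have key : ∀ l m, f (algebraMap L (F i) l * algebraMap M (F i) m) = a l * b m := by
    intro l m
    rw [← he, ← hf]
    change β (e.symm (e _)) = _
    rw [e.symm_apply_apply]
    exact Algebra.TensorProduct.productMap_apply_tmul a' b' l m
  exact ⟨i, f, fun l => by simpa using key l 1, fun m => by simpa using key 1 m⟩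

/-- Each factor of `L ⊗[K] M` is generated by the images of `L` and `M`. -/
theorem factor_induction
    (he : ∀ (i : Fin n) (l : L) (m : M),
      e (l ⊗ₜ[K] m) i = algebraMap L (F i) l * algebraMap M (F i) m)
    {i : Fin n} {P : F i → Prop}
    (hmul : ∀ l m, P (algebraMap L (F i) l * algebraMap M (F i) m))
    (hadd : ∀ x y, P x → P y → P (x + y)) (x : F i) : P x := by
  have key : ∀ t : L ⊗[K] M, P (e t i) := by
    intro t
    induction t with
    | zero => simpa using hmul 0 0
    | tmul l m => rw [he]; exact hmul l m
    | add s t hs ht => rw [map_add]; exact hadd _ _ hs ht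
  simpa using key (e.symm (Pi.single i x))

theorem factor_hom_apply_eq
    (he : ∀ (i : Fin n) (l : L) (m : M),
      e (l ⊗ₜ[K] m) i = algebraMap L (F i) l * algebraMap M (F i) m)
    {Ω : Type*} [Field Ω] {i j : Fin n} {f : F i →+* Ω} {g : F j →+* Ω}
    (hL : ∀ l, f (algebraMap L (F i) l) = g (algebraMap L (F j) l))
    (hM : ∀ m, f (algebraMap M (F i) m) = g (algebraMap M (F j) m)) (x : (i : Fin n) → F i) :
    f (x i) = g (x j) := by
  have key : ∀ t : L ⊗[K] M, f (e t i) = g (e t j) := by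
    intro t
    induction t with
    | zero => simp
    | tmul l m => rw [he, he, map_mul, map_mul, hL, hM]
    | add s t hs ht => rw [map_add, Pi.add_apply, Pi.add_apply, map_add, map_add, hs, ht]
  simpa using key (e.symm x)

/-- The factor of `L ⊗[K] M` through which a pair of embeddings factors is unique. -/
theorem factor_index_eq
    (he : ∀ (i : Fin n) (l : L) (m : M),
      e (l ⊗ₜ[K] m) i = algebraMap L (F i) l * algebraMap M (F i) m)
    {Ω : Type*} [Field Ω] {i j : Fin n} {f : F i →+* Ω} {g : F j →+* Ω}
    (hL : ∀ l, f (algebraMap L (F i) l) = g (algebraMap L (F j) l))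
    (hM : ∀ m, f (algebraMap M (F i) m) = g (algebraMap M (F j) m)) : i = j := by
  by_contra hij
  have h := factor_hom_apply_eq he hL hM (Pi.single i 1)
  rw [Pi.single_eq_same, Pi.single_eq_of_ne (Ne.symm hij), map_one, map_zero] at h
  exact one_ne_zero h

end TensorDecomposition

/-- A total, surjective, functional relation `R` whose fibres are the classes of `r` identifies its
target with `Quot r`. -/
theorem nonempty_equiv_quot {A B : Type*} {r : A → A → Prop} (R : A → B → Prop)
    (hA : ∀ a, ∃ b, R a b) (hB : ∀ b, ∃ a, R a b) (huniq : ∀ a b b', R a b → R a b' → b = b')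
    (hr : ∀ a a' b, r a a' → R a b → R a' b) (hsound : ∀ a a' b, R a b → R a' b → r a a') :
    Nonempty (B ≃ Quot r) := by
  choose f hf using hA
  have hlift : ∀ a a', r a a' → f a = f a' := fun a a' h =>
    huniq a' _ _ (hr a a' _ h (hf a)) (hf a')
  refine ⟨(Equiv.ofBijective (Quot.lift f hlift) ⟨?_, fun b => ?_⟩).symm⟩
  · rintro ⟨a⟩ ⟨a'⟩ (h : f a = f a')
    exact Quot.sound (hsound a a' (f a) (hf a) (h ▸ hf a'))
  · obtain ⟨a, ha⟩ := hB b
    exact ⟨Quot.mk r a, huniq a _ _ (hf a) ha⟩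

/-- Two embeddings of `L̂` into the algebraic closure of `M̂` that induce the same absolute value
on a composite of `L` and `M` are conjugate over `M̂`. -/
theorem exists_conj_of_induced_eq {L M F Kh Lh Mh Ma : Type*} [Field L] [Field M] [Field F]
    [Algebra L F] [Algebra M F] [Field Kh] [Field Lh] [Field Mh] [Field Ma] [Algebra L Lh]
    [Algebra M Mh] [Algebra Kh Lh] [Algebra Kh Mh] [Algebra Mh Ma] [IsAlgClosure Mh Ma]
    [Algebra Kh Ma] [IsScalarTower Kh Mh Ma]
    {vL : AbsoluteValue L ℝ} {vM : AbsoluteValue M ℝ} {vLh : AbsoluteValue Lh ℝ}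
    {vMh : AbsoluteValue Mh ℝ} {v : AbsoluteValue Ma ℝ} {w : AbsoluteValue F ℝ}
    (hLh : IsCompletion vL vLh (algebraMap L Lh)) (hMh : IsCompletion vM vMh (algebraMap M Mh))
    (hv : ExtendsAV vMh v (algebraMap Mh Ma)) {φ ψ : Lh →ₐ[Kh] Ma}
    (hφ : ExtendsAV vLh v (φ : Lh →+* Ma)) (hψ : ExtendsAV vLh v (ψ : Lh →+* Ma))
    {f g : F →+* Ma} (hfL : ∀ l, f (algebraMap L F l) = φ (algebraMap L Lh l))
    (hgL : ∀ l, g (algebraMap L F l) = ψ (algebraMap L Lh l))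
    (hfM : ∀ m, f (algebraMap M F m) = algebraMap Mh Ma (algebraMap M Mh m))
    (hgM : ∀ m, g (algebraMap M F m) = algebraMap Mh Ma (algebraMap M Mh m))
    (hfw : ∀ x, v (f x) = w x) (hgw : ∀ x, v (g x) = w x) :
    ∃ τ : Ma ≃ₐ[Mh] Ma, ∀ x, ψ x = τ (φ x) := by
  let φ' : (Mh ⊗[Kh] Lh) →ₐ[Mh] Ma :=
    Algebra.TensorProduct.lift (Algebra.ofId Mh Ma) φ fun _ _ => Commute.all _ _
  let ψ' : (Mh ⊗[Kh] Lh) →ₐ[Mh] Ma :=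
    Algebra.TensorProduct.lift (Algebra.ofId Mh Ma) ψ fun _ _ => Commute.all _ _
  have bound : ∀ (χ : Lh →ₐ[Kh] Ma), ExtendsAV vLh v (χ : Lh →+* Ma) → ∀ a y m l,
      v (algebraMap Mh Ma a * χ y -
        algebraMap Mh Ma (algebraMap M Mh m) * χ (algebraMap L Lh l)) ≤
      vMh (a - algebraMap M Mh m) * vLh y + vM m * vLh (y - algebraMap L Lh l) := by
    intro χ hχ a y m l
    have hχ' : ∀ z, v (χ z) = vLh z := hχ
    have h := v.add_le (algebraMap Mh Ma (a - algebraMap M Mh m) * χ y)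
      (algebraMap Mh Ma (algebraMap M Mh m) * χ (y - algebraMap L Lh l))
    rw [map_mul, map_mul, hv, hv, hχ', hχ', hMh.extendsAV] at h
    refine le_trans (le_of_eq ?_) h
    rw [map_sub (algebraMap Mh Ma), map_sub χ]
    congr 1
    ring
  have approx : ∀ t : Mh ⊗[Kh] Lh, ∀ ε : ℝ, 0 < ε →
      ∃ x : F, v (φ' t - f x) < ε ∧ v (ψ' t - g x) < ε := by
    intro t
    induction t with
    | zero => exact fun ε hε => ⟨0, by simpa using hε, by simpa using hε⟩
    | tmul a y =>
      intro ε hε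
      have hy := vLh.nonneg y
      obtain ⟨m, hm⟩ := hMh.dense a (ε / 2 / (vLh y + 1)) (by positivity)
      have hm0 := vM.nonneg m
      obtain ⟨l, hl⟩ := hLh.dense y (ε / 2 / (vM m + 1)) (by positivity)
      rw [lt_div_iff₀ (by positivity)] at hm hl
      have h1 := vMh.nonneg (a - algebraMap M Mh m)
      have h2 := vLh.nonneg (y - algebraMap L Lh l)
      refine ⟨algebraMap M F m * algebraMap L F l, ?_, ?_⟩
      · rw [map_mul, hfL, hfM]
        refine (bound φ hφ a y m l).trans_lt ?_
        nlinarith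
      · rw [map_mul, hgL, hgM]
        refine (bound ψ hψ a y m l).trans_lt ?_
        nlinarith
    | add s t hs ht =>
      intro ε hε
      obtain ⟨x, hx1, hx2⟩ := hs (ε / 2) (half_pos hε)
      obtain ⟨y, hy1, hy2⟩ := ht (ε / 2) (half_pos hε)
      refine ⟨x + y, ?_, ?_⟩
      · rw [map_add, map_add, add_sub_add_comm]
        exact (v.add_le _ _).trans_lt (by linarith)
      · rw [map_add, map_add, add_sub_add_comm]
        exact (v.add_le _ _).trans_lt (by linarith)
  have habs : ∀ t, v (φ' t) = v (ψ' t) := by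
    intro t
    by_contra hne
    obtain ⟨x, h1, h2⟩ := approx t (|v (φ' t) - v (ψ' t)| / 2)
      (half_pos (abs_pos.2 (sub_ne_zero.2 hne)))
    have h3 := v.abs_abv_sub_le_abv_sub (φ' t) (f x)
    have h4 := v.abs_abv_sub_le_abv_sub (ψ' t) (g x)
    rw [hfw] at h3
    rw [hgw] at h4
    have h5 := abs_sub_le (v (φ' t)) (w x) (v (ψ' t))
    rw [abs_sub_comm (w x)] at h5
    linarith
  obtain ⟨τ, hτ⟩ := IsAlgClosure.exists_algEquiv_of_ker_eq (f := φ') (g := ψ') fun t => by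
    rw [← v.eq_zero, habs, v.eq_zero]
  refine ⟨τ, fun x => ?_⟩
  simpa [φ', ψ'] using hτ (1 ⊗ₜ x)

/-- An absolute value on a composite `F` of `L` and `M` is induced by embeddings of `L̂` and `F`
into the algebraic closure of `M̂`. -/
theorem exists_embedding_of_extends {K L M F Kh Lh Mh : Type*} (Ma : Type*) [Field K] [Field L]
    [Field M] [Field F] [Field Kh] [Field Lh] [Field Mh] [Field Ma] [Algebra K L] [Algebra K M]
    [Algebra K F] [Algebra L F] [Algebra M F] [IsScalarTower K L F] [IsScalarTower K M F]
    [Algebra K Kh] [Algebra L Lh] [Algebra M Mh] [Algebra Kh Lh] [Algebra Kh Mh]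
    [Algebra K Lh] [Algebra K Mh] [IsScalarTower K Kh Lh] [IsScalarTower K L Lh]
    [IsScalarTower K Kh Mh] [IsScalarTower K M Mh]
    [Algebra Mh Ma] [IsAlgClosure Mh Ma] [Algebra Kh Ma] [IsScalarTower Kh Mh Ma]
    {vK : AbsoluteValue K ℝ} {vL : AbsoluteValue L ℝ} {vM : AbsoluteValue M ℝ}
    {vKh : AbsoluteValue Kh ℝ} {vLh : AbsoluteValue Lh ℝ} {vMh : AbsoluteValue Mh ℝ}
    {v : AbsoluteValue Ma ℝ} {w : AbsoluteValue F ℝ}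
    (hKh : IsCompletion vK vKh (algebraMap K Kh)) (hLh : IsCompletion vL vLh (algebraMap L Lh))
    (hMh : IsCompletion vM vMh (algebraMap M Mh))
    (hKhLh : ExtendsAV vKh vLh (algebraMap Kh Lh)) (hKhMh : ExtendsAV vKh vMh (algebraMap Kh Mh))
    [Algebra.IsAlgebraic Kh Lh] (hv : ExtendsAV vMh v (algebraMap Mh Ma))
    (hwL : ExtendsAV vL w (algebraMap L F)) (hwM : ExtendsAV vM w (algebraMap M F))
    (hF : ∀ P : F → Prop, (∀ l m, P (algebraMap L F l * algebraMap M F m)) →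
      (∀ x y, P x → P y → P (x + y)) → ∀ x, P x) :
    ∃ (φ : Lh →ₐ[Kh] Ma) (f : F →+* Ma), (∀ l, f (algebraMap L F l) = φ (algebraMap L Lh l)) ∧
      (∀ m, f (algebraMap M F m) = algebraMap Mh Ma (algebraMap M Mh m)) ∧
      ∀ x, v (f x) = w x := by
  have := IsAlgClosure.isAlgClosed Mh (K := Ma)
  obtain ⟨C, _, vC, j, hC⟩ := w.exists_isCompletion
  obtain ⟨gL, hgL, hgL'⟩ := hLh.exists_extend hC.complete (g := j.comp (algebraMap L F))
    fun x => (hC.extendsAV _).trans (hwL x)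
  obtain ⟨gM, hgM, hgM'⟩ := hMh.exists_extend hC.complete (g := j.comp (algebraMap M F))
    fun x => (hC.extendsAV _).trans (hwM x)
  have hagree : ∀ y : Kh, gL (algebraMap Kh Lh y) = gM (algebraMap Kh Mh y) :=
    hKh.hom_ext (g := gL.comp (algebraMap Kh Lh)) (h := gM.comp (algebraMap Kh Mh))
      (fun y => (hgL' _).trans (hKhLh y)) (fun y => (hgM' _).trans (hKhMh y)) fun k => by
        simp only [RingHom.comp_apply]
        rw [← IsScalarTower.algebraMap_apply K Kh Lh, ← IsScalarTower.algebraMap_apply K Kh Mh,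
          IsScalarTower.algebraMap_apply K L Lh, IsScalarTower.algebraMap_apply K M Mh, hgL, hgM]
        simp only [RingHom.comp_apply]
        rw [← IsScalarTower.algebraMap_apply K L F, ← IsScalarTower.algebraMap_apply K M F]
  let : Algebra Mh C := gM.toAlgebra
  let : Algebra Kh C := (gM.comp (algebraMap Kh Mh)).toAlgebra
  have : IsScalarTower Kh Mh C := .of_algebraMap_eq' rfl
  let gL' : Lh →ₐ[Kh] C := { gL with commutes' := hagree }
  let A := algebraicClosure Mh C
  have hLA : ∀ y, gL y ∈ A := fun y => by
    have hy : IsIntegral Kh (gL' y) := (Algebra.IsIntegral.isIntegral y).map gL'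
    exact mem_algebraicClosure_iff.2 hy.tower_top.isAlgebraic
  have hMA : ∀ y, gM y ∈ A := fun y => A.algebraMap_mem y
  have hFA : ∀ x, j x ∈ A := by
    refine hF _ (fun l m => ?_) fun x y hx hy => ?_
    · rw [map_mul]
      exact A.mul_mem (by simpa [hgL] using hLA (algebraMap L Lh l))
        (by simpa [hgM] using hMA (algebraMap M Mh m))
    · rw [map_add]
      exact A.add_mem hx hy
  let ι : A →ₐ[Mh] Ma := IsAlgClosed.lift
  have hι : ∀ y, v (ι y) = vC y :=
    AbsoluteValue.eq_of_extends hMh.complete (w₁ := v.comapRH (ι : A →+* Ma))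
      (w₂ := vC.comapRH (algebraMap A C))
      (fun y => by
        change v (ι (algebraMap Mh A y)) = _
        rw [ι.commutes, hv]) hgM'
  refine ⟨{ (ι : A →+* Ma).comp (gL.codRestrict A hLA) with commutes' := fun k => ?_ },
    (ι : A →+* Ma).comp (j.codRestrict A hFA), fun l => ?_, fun m => ?_, fun x => ?_⟩
  · rw [IsScalarTower.algebraMap_apply Kh Mh Ma, ← ι.commutes]
    exact congrArg ι (Subtype.ext (hagree k))
  · exact congrArg ι (Subtype.ext (hgL l).symm)
  · rw [← ι.commutes]
    exact congrArg ι (Subtype.ext (hgM m).symm)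
  · exact (hι _).trans (hC.extendsAV x)

/-- **Theorem (global), part (1).**
Let `L/K` and `M/K` be field extensions with `L/K` finite and separable, and let `vL`, `vM`
be absolute values on `L` and `M` extending the same absolute value `vK` on `K`.  Decompose
`L ⊗[K] M ≃ F₁ × ⋯ × Fₙ` as a product of fields, each `Fᵢ` being an extension of both `L`
and `M` compatibly with `K`.  Let `K̂ = Kh`, `L̂ = Lh`, `M̂ = Mh` be the completions and let
`Ma = M̂ᵃ` be an algebraic closure of `M̂`.  Then there is a bijection between the disjoint
union of the sets `𝒱ᵢ` of absolute values on `Fᵢ` extending both `vL` and `vM`, and the set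
of equivalence classes of `K̂`-algebra embeddings `L̂ → M̂ᵃ`, where two embeddings are
equivalent iff they differ by composition with an `M̂`-algebra automorphism of `M̂ᵃ`. -/
theorem global_count
    {K L M : Type*} [Field K] [Field L] [Field M]
    [Algebra K L] [Algebra K M]
    [FiniteDimensional K L] [Algebra.IsSeparable K L]
    (vK : AbsoluteValue K ℝ) (vL : AbsoluteValue L ℝ) (vM : AbsoluteValue M ℝ)
    (hvL : ExtendsAV vK vL (algebraMap K L)) (hvM : ExtendsAV vK vM (algebraMap K M))
    -- the decomposition of `L ⊗[K] M` as a finite product of fields `Fᵢ`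
    {n : ℕ} (F : Fin n → Type*) [∀ i, Field (F i)]
    [∀ i, Algebra K (F i)] [∀ i, Algebra L (F i)] [∀ i, Algebra M (F i)]
    [∀ i, IsScalarTower K L (F i)] [∀ i, IsScalarTower K M (F i)]
    (e : (L ⊗[K] M) ≃ₐ[K] ((i : Fin n) → F i))
    (he : ∀ (i : Fin n) (l : L) (m : M),
      e (l ⊗ₜ[K] m) i = algebraMap L (F i) l * algebraMap M (F i) m)
    -- the completions `K̂`, `L̂`, `M̂`
    {Kh Lh Mh : Type*} [Field Kh] [Field Lh] [Field Mh]
    [Algebra K Kh] [Algebra L Lh] [Algebra M Mh]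
    [Algebra Kh Lh] [Algebra Kh Mh] [Algebra K Lh] [Algebra K Mh]
    [IsScalarTower K Kh Lh] [IsScalarTower K L Lh]
    [IsScalarTower K Kh Mh] [IsScalarTower K M Mh]
    (vKh : AbsoluteValue Kh ℝ) (vLh : AbsoluteValue Lh ℝ) (vMh : AbsoluteValue Mh ℝ)
    (hKh : IsCompletion vK vKh (algebraMap K Kh))
    (hLh : IsCompletion vL vLh (algebraMap L Lh))
    (hMh : IsCompletion vM vMh (algebraMap M Mh))
    (hKhLh : ExtendsAV vKh vLh (algebraMap Kh Lh))
    (hKhMh : ExtendsAV vKh vMh (algebraMap Kh Mh))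
    -- an algebraic closure `M̂ᵃ` of `M̂`
    {Ma : Type*} [Field Ma] [Algebra Mh Ma] [IsAlgClosure Mh Ma]
    [Algebra Kh Ma] [IsScalarTower Kh Mh Ma] :
    Nonempty (
      (Σ i : Fin n, {w : AbsoluteValue (F i) ℝ //
          ExtendsAV vL w (algebraMap L (F i)) ∧ ExtendsAV vM w (algebraMap M (F i))})
      ≃ Quot (fun φ ψ : Lh →ₐ[Kh] Ma => ∃ τ : Ma ≃ₐ[Mh] Ma, ∀ x : Lh, ψ x = τ (φ x))) := by
  have := IsAlgClosure.isAlgebraic (R := Mh) (K := Ma)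
  have hLhalg : Algebra.IsAlgebraic Kh Lh := hLh.isAlgebraic (K := K) hKh.complete hKhLh
  obtain ⟨v, hv⟩ := AbsoluteValue.exists_extension Ma hMh.complete
  have hvK : ∀ k, v (algebraMap Kh Ma k) = vKh k := fun k => by
    rw [IsScalarTower.algebraMap_apply Kh Mh Ma, hv, hKhMh]
  have hφ : ∀ (φ : Lh →ₐ[Kh] Ma), ExtendsAV vLh v (φ : Lh →+* Ma) := fun φ y =>
    AbsoluteValue.eq_of_extends hKh.complete (w₁ := v.comapRH (φ : Lh →+* Ma)) (w₂ := vLh)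
      (fun k => by
        change v (φ (algebraMap Kh Lh k)) = _
        rw [φ.commutes, hvK]) hKhLh y
  have hτ : ∀ (τ : Ma ≃ₐ[Mh] Ma) (x : Ma), v (τ x) = v x := fun τ x =>
    AbsoluteValue.eq_of_extends hMh.complete (w₁ := v.comapRH (τ : Ma →+* Ma)) (w₂ := v)
      (fun k => by
        change v (τ (algebraMap Mh Ma k)) = _
        rw [τ.commutes, hv]) hv x
  refine nonempty_equiv_quot (fun φ p => ∃ f : F p.1 →+* Ma,
    (∀ l, f (algebraMap L (F p.1) l) = φ (algebraMap L Lh l)) ∧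
    (∀ m, f (algebraMap M (F p.1) m) = algebraMap Mh Ma (algebraMap M Mh m)) ∧
    ∀ x, v (f x) = p.2.1 x) ?_ ?_ ?_ ?_ ?_
  · intro φ
    obtain ⟨i, f, hfL, hfM⟩ := exists_factor_hom he
      (a := (φ : Lh →+* Ma).comp (algebraMap L Lh))
      (b := (algebraMap Mh Ma).comp (algebraMap M Mh)) fun k => by
        simp only [RingHom.comp_apply, RingHom.coe_coe]
        rw [← IsScalarTower.algebraMap_apply K L Lh, ← IsScalarTower.algebraMap_apply K M Mh,
          IsScalarTower.algebraMap_apply K Kh Lh, IsScalarTower.algebraMap_apply K Kh Mh,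
          φ.commutes, ← IsScalarTower.algebraMap_apply Kh Mh Ma]
    refine ⟨⟨i, v.comapRH f, fun l => ?_, fun m => ?_⟩, f, hfL, hfM, fun x => rfl⟩
    · change v (f _) = _
      rw [hfL]
      exact (hφ φ _).trans (hLh.extendsAV l)
    · change v (f _) = _
      rw [hfM]
      exact (hv _).trans (hMh.extendsAV m)
  · rintro ⟨i, w, hwL, hwM⟩
    exact exists_embedding_of_extends Ma hKh hLh hMh hKhLh hKhMh hv hwL hwM
      fun P hmul hadd => factor_induction he hmul hadd
  · rintro φ ⟨i, w, hw⟩ ⟨j, w', hw'⟩ ⟨f, hfL, hfM, hfw⟩ ⟨g, hgL, hgM, hgw⟩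
    have hL := fun l => (hfL l).trans (hgL l).symm
    have hM := fun m => (hfM m).trans (hgM m).symm
    obtain rfl : i = j := factor_index_eq he hL hM
    obtain rfl : w = w' := by
      ext x
      have h := factor_hom_apply_eq he hL hM (Pi.single i x)
      rw [Pi.single_eq_same] at h
      exact (hfw x).symm.trans ((congrArg v h).trans (hgw x))
    rfl
  · rintro φ ψ p ⟨τ, hψ⟩ ⟨f, hfL, hfM, hfw⟩
    refine ⟨(τ : Ma →+* Ma).comp f, fun l => ?_, fun m => ?_, fun x => ?_⟩
    · rw [hψ, ← hfL]
      rfl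
    · rw [← τ.commutes, ← hfM]
      rfl
    · exact (hτ τ _).trans (hfw x)
  · rintro φ ψ p ⟨f, hfL, hfM, hfw⟩ ⟨g, hgL, hgM, hgw⟩
    exact exists_conj_of_induced_eq hLh hMh hv (hφ φ) (hφ ψ) hfL hgL hfM hgM hfw hgw
end
end

section
/- For every j ∈ {1,…,m}, the triple (G_j, |·|_j, ι_j) is a completion of the field F_{σ(j)} with respect to the restriction of |·|_j along ι_j; in particular F_{σ(j)} is dense in G_j and |·|_j extends the restricted absolute value along ι_j. -/
noncomputable section

theorem AbsoluteValue.eq_one_of_finiteDimensional_of_trivial {A B : Type*} [Field A] [Field B]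
    [Algebra A B] [FiniteDimensional A B] (v : AbsoluteValue A ℝ) (w : AbsoluteValue B ℝ)
    (hw : ExtendsAV v w (algebraMap A B)) (hv : ∀ a, v a ≤ 1) {x : B} (hx : x ≠ 0) :
    w x = 1 := by
  let b := Module.finBasis A B
  have bounded (y : B) : w y ≤ ∑ i, w (b i) := by
    calc w y = w (∑ i, b.repr y i • b i) := by rw [b.sum_repr]
      _ ≤ ∑ i, w (b.repr y i • b i) := w.sum_le _ _
      _ ≤ ∑ i, w (b i) := by
        refine Finset.sum_le_sum fun i _ => ?_
        rw [Algebra.smul_def, map_mul, hw]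
        exact mul_le_of_le_one_left (w.nonneg _) (hv _)
  have le_one (y : B) : w y ≤ 1 := by
    by_contra! h
    obtain ⟨n, hn⟩ := pow_unbounded_of_one_lt (∑ i, w (b i)) h
    exact absurd (bounded (y ^ n)) (by rw [map_pow]; exact not_le.mpr hn)
  refine le_antisymm (le_one x) ?_
  have hinv := le_one x⁻¹
  rw [map_inv₀] at hinv
  exact (inv_le_one₀ (w.pos hx)).mp hinv

theorem absComplete_of_finiteDimensional_of_trivial {A B : Type*} [Field A] [Field B]
    [Algebra A B] [FiniteDimensional A B] (v : AbsoluteValue A ℝ) (w : AbsoluteValue B ℝ)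
    (hw : ExtendsAV v w (algebraMap A B)) (hv : ∀ a, v a ≤ 1) : AbsComplete w := by
  intro s hs
  obtain ⟨N, hN⟩ := hs 1 one_pos
  refine ⟨s N, fun ε hε => ⟨N, fun n hn => ?_⟩⟩
  have : s n - s N = 0 := by
    by_contra h
    exact (hN n hn N le_rfl).ne (v.eq_one_of_finiteDimensional_of_trivial w hw hv h)
  rwa [this, map_zero]

theorem absComplete_iff_completeSpace {A : Type*} [Field A] (v : AbsoluteValue A ℝ) :
    AbsComplete v ↔ letI := v.toNormedField; CompleteSpace A := by
  let := v.toNormedField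
  have dist_def (x y : A) : dist x y = v (x - y) := dist_eq_norm x y
  constructor
  · intro h
    refine Metric.complete_of_cauchySeq_tendsto fun u hu => ?_
    obtain ⟨a, ha⟩ := h u fun ε hε => by
      simpa only [dist_def] using Metric.cauchySeq_iff.mp hu ε hε
    exact ⟨a, Metric.tendsto_atTop.mpr fun ε hε => by simpa only [dist_def] using ha ε hε⟩
  · intro h s hs
    obtain ⟨a, ha⟩ := cauchySeq_tendsto_of_complete (u := s)
      (Metric.cauchySeq_iff.mpr fun ε hε => by simpa only [dist_def] using hs ε hε)
    exact ⟨a, fun ε hε => by simpa only [dist_def] using Metric.tendsto_atTop.mp ha ε hε⟩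

theorem absComplete_of_finiteDimensional {A B : Type*} [Field A] [Field B]
    [Algebra A B] [FiniteDimensional A B] (v : AbsoluteValue A ℝ) (w : AbsoluteValue B ℝ)
    (hw : ExtendsAV v w (algebraMap A B)) (hv : AbsComplete v) : AbsComplete w := by
  by_cases htriv : ∀ a, v a ≤ 1
  · exact absComplete_of_finiteDimensional_of_trivial v w hw htriv
  push Not at htriv
  let : NontriviallyNormedField A := { v.toNormedField with non_trivial := htriv }
  let : NormedField B := w.toNormedField
  let : NormedAlgebra A B :=
    { (inferInstance : Algebra A B) with
      norm_smul_le := fun r x => by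
        change w (r • x) ≤ v r * w x
        rw [Algebra.smul_def, map_mul, hw] }
  have : CompleteSpace A := (absComplete_iff_completeSpace v).mp hv
  exact (absComplete_iff_completeSpace w).mpr (FiniteDimensional.complete A B)

theorem finiteDimensional_of_adjoin_singleton_eq_top {A B : Type*} [Field A] [Field B]
    [Algebra A B] {y : B} (hy : IsIntegral A y) (hgen : Algebra.adjoin A {y} = ⊤) :
    FiniteDimensional A B := by
  refine ⟨?_⟩
  rw [← Algebra.top_toSubmodule, ← hgen]
  exact hy.fg_adjoin_singleton

/-- If `M` is dense in `A` and `B = A[y]`, then any subfield of `B` containing `M` and `y`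
is dense in `B`. -/
theorem exists_absoluteValue_sub_lt_of_adjoin_singleton_eq_top {M A B F : Type*} [Field M]
    [Field A] [Field B] [Field F] [Algebra M A] [Algebra A B] [Algebra M B] [IsScalarTower M A B]
    [Algebra M F] (v : AbsoluteValue A ℝ) (w : AbsoluteValue B ℝ)
    (hw : ExtendsAV v w (algebraMap A B))
    (hdense : ∀ a : A, ∀ ε : ℝ, 0 < ε → ∃ c : M, v (a - algebraMap M A c) < ε)
    {y : B} (hgen : Algebra.adjoin A {y} = ⊤) (φ : F →ₐ[M] B) {x : F} (hx : φ x = y) (z : B)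
    {ε : ℝ} (hε : 0 < ε) : ∃ u : F, w (z - φ u) < ε := by
  obtain ⟨p, rfl⟩ : z ∈ (Polynomial.aeval (R := A) y).range := by
    rw [← Algebra.adjoin_singleton_eq_range_aeval, hgen]
    exact Algebra.mem_top
  change ∃ u : F, w (Polynomial.aeval y p - φ u) < ε
  induction p using Polynomial.induction_on' generalizing ε with
  | add p q hp hq =>
    obtain ⟨a, ha⟩ := hp (half_pos hε)
    obtain ⟨b, hb⟩ := hq (half_pos hε)
    refine ⟨a + b, ?_⟩
    rw [map_add, map_add, add_sub_add_comm]
    exact (w.add_le _ _).trans_lt (by linarith)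
  | monomial n a =>
    have hpos : 0 < w y ^ n + 1 := by have := w.nonneg y; positivity
    obtain ⟨c, hc⟩ := hdense a (ε / (w y ^ n + 1)) (by positivity)
    refine ⟨algebraMap M F c * x ^ n, ?_⟩
    rw [Polynomial.aeval_monomial, map_mul, map_pow, hx, AlgHom.commutes,
      IsScalarTower.algebraMap_apply M A B, ← sub_mul, ← map_sub, map_mul, map_pow, hw]
    rw [lt_div_iff₀ hpos] at hc
    nlinarith [v.nonneg (a - algebraMap M A c)]

/-- **Lemma (Gⱼ is a completion of F_{σ(j)}).**
For every `j`, the triple `(Gⱼ, vG j, ιⱼ)` is a completion of the field `F_{σ(j)}` with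
respect to the restriction of `vG j` along `ιⱼ`: the restriction is an absolute value on
`F_{σ(j)}`, `Gⱼ` is complete, and `F_{σ(j)}` is dense in `Gⱼ`. -/
theorem Gj_is_completion
    {K M : Type*} [Field K] [Field M] [Algebra K M]
    (vK : AbsoluteValue K ℝ) (vM : AbsoluteValue M ℝ)
    (hvM : ExtendsAV vK vM (algebraMap K M))
    -- the completions `K̂` and `M̂`
    {Kh Mh : Type*} [Field Kh] [Field Mh]
    [Algebra K Kh] [Algebra M Mh] [Algebra K Mh] [Algebra Kh Mh]
    [IsScalarTower K Kh Mh] [IsScalarTower K M Mh]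
    (vKh : AbsoluteValue Kh ℝ) (vMh : AbsoluteValue Mh ℝ)
    (hKh : IsCompletion vK vKh (algebraMap K Kh))
    (hMh : IsCompletion vM vMh (algebraMap M Mh))
    (hKhMh : ExtendsAV vKh vMh (algebraMap Kh Mh))
    -- `f` : the minimal polynomial of `s` over `K`, factored over `M` as `f = f₁ ⋯ fₙ`
    (f : Polynomial K) (hfmonic : f.Monic) (hfirr : Irreducible f)
    {n : ℕ} (fi : Fin n → Polynomial M)
    (hfi : ∀ i, (fi i).Monic ∧ Irreducible (fi i)) (hfidist : Function.Injective fi)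
    (hffi : f.map (algebraMap K M) = ∏ i, fi i)
    -- `g` : the minimal polynomial of `s` over `K̂` (a monic irreducible factor of `f`
    -- over `K̂`), factored over `M̂` as `g = g₁ ⋯ gₘ`
    (g : Polynomial Kh) (hgmonic : g.Monic) (hgirr : Irreducible g)
    (hgf : g ∣ f.map (algebraMap K Kh))
    {m : ℕ} (gj : Fin m → Polynomial Mh)
    (hgj : ∀ j, (gj j).Monic ∧ Irreducible (gj j)) (hgjdist : Function.Injective gj)
    (hggj : g.map (algebraMap Kh Mh) = ∏ j, gj j)
    -- the map `σ` with `gⱼ ∣ f_{σ(j)}` over `M̂`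
    (σ : Fin m → Fin n) (hσ : ∀ j, gj j ∣ (fi (σ j)).map (algebraMap M Mh))
    -- `Fᵢ = M[X]/(fᵢ)`, presented as the field generated over `M` by a root `xi i` of `fᵢ`
    (Fi : Fin n → Type*) [∀ i, Field (Fi i)] [∀ i, Algebra M (Fi i)]
    (xi : (i : Fin n) → Fi i) (hxi : ∀ i, minpoly M (xi i) = fi i)
    (hxigen : ∀ i, Algebra.adjoin M {xi i} = ⊤)
    -- `Gⱼ = M̂[X]/(gⱼ)`, presented as the field generated over `M̂` by a root `yj j` of `gⱼ`,
    -- equipped with the unique absolute value `vG j` extending that of `M̂`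
    (Gj : Fin m → Type*) [∀ j, Field (Gj j)] [∀ j, Algebra Mh (Gj j)]
    [∀ j, Algebra M (Gj j)] [∀ j, IsScalarTower M Mh (Gj j)]
    (yj : (j : Fin m) → Gj j) (hyj : ∀ j, minpoly Mh (yj j) = gj j)
    (hyjgen : ∀ j, Algebra.adjoin Mh {yj j} = ⊤)
    (vG : (j : Fin m) → AbsoluteValue (Gj j) ℝ)
    (hvG : ∀ j, ExtendsAV vMh (vG j) (algebraMap Mh (Gj j)))
    -- the natural `M`-algebra embedding `ιⱼ : F_{σ(j)} → Gⱼ`, sending root to root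
    (ι : (j : Fin m) → (Fi (σ j) →ₐ[M] Gj j)) (hι : ∀ j, ι j (xi (σ j)) = yj j)
    :
    ∀ j : Fin m,
      IsCompletion ((vG j).comapRH (ι j).toRingHom) (vG j) (ι j).toRingHom := by
  intro j
  have hint : IsIntegral Mh (yj j) := by
    by_contra h
    exact (hgj j).2.ne_zero (hyj j ▸ minpoly.eq_zero h)
  have := finiteDimensional_of_adjoin_singleton_eq_top hint (hyjgen j)
  exact
    { extendsAV := fun _ => rfl
      complete := absComplete_of_finiteDimensional vMh (vG j) (hvG j) hMh.complete
      dense := fun z _ hε => exists_absoluteValue_sub_lt_of_adjoin_singleton_eq_top vMh (vG j)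
        (hvG j) hMh.dense (hyjgen j) (ι j) (hι j) z hε }
end
end

section
/- Two embeddings α₁, α₂ ∈ ℰ satisfy Φ(α₁) = Φ(α₂) if and only if there exists an M̂-algebra automorphism τ of M̂^a with α₂ = τ ∘ α₁. -/
noncomputable section

theorem le_of_forall_pow_le_mul_pow {a b C : ℝ} (hb : 0 ≤ b)
    (h : ∀ n : ℕ, a ^ n ≤ C * b ^ n) : a ≤ b := by
  by_contra! hab
  rcases hb.eq_or_lt with rfl | hb
  · have := h 1
    simp at this
    linarith
  · obtain ⟨n, hn⟩ := pow_unbounded_of_one_lt C ((one_lt_div hb).2 hab)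
    rw [div_pow, lt_div_iff₀ (pow_pos hb n)] at hn
    exact (h n).not_gt hn

/-- An algebraic algebra endomorphism over a complete nontrivially normed field does not
increase a multiplicative norm. -/
theorem norm_algHom_apply_le {k A : Type*} [NontriviallyNormedField k] [CompleteSpace k]
    [NormedField A] [NormedAlgebra k A] [Algebra.IsAlgebraic k A] (σ : A →ₐ[k] A) (x : A) :
    ‖σ x‖ ≤ ‖x‖ := by
  let E := IntermediateField.adjoin k {x}
  have : FiniteDimensional k E :=
    IntermediateField.adjoin.finiteDimensional (Algebra.IsAlgebraic.isAlgebraic x).isIntegral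
  let f : E →L[k] A := LinearMap.toContinuousLinearMap (σ.toLinearMap ∘ₗ E.val.toLinearMap)
  let g : E := ⟨x, IntermediateField.mem_adjoin_simple_self k x⟩
  refine le_of_forall_pow_le_mul_pow (C := ‖f‖) (norm_nonneg x) fun n ↦ ?_
  have h := f.le_opNorm (g ^ n)
  have hf : f (g ^ n) = σ x ^ n := by
    simp [f, g]
  have hg : ‖g ^ n‖ = ‖x‖ ^ n := norm_pow x n
  rwa [hf, hg, norm_pow] at h

/-- An absolute value on an algebraic extension that is bounded by one on the base field is bounded
by one. -/
theorem absoluteValue_le_one_of_isAlgebraic {k A : Type*} [Field k] [Field A] [Algebra k A]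
    [Algebra.IsAlgebraic k A] (w : AbsoluteValue A ℝ)
    (hw : ∀ c : k, w (algebraMap k A c) ≤ 1) (x : A) : w x ≤ 1 := by
  let E := IntermediateField.adjoin k {x}
  have : FiniteDimensional k E :=
    IntermediateField.adjoin.finiteDimensional (Algebra.IsAlgebraic.isAlgebraic x).isIntegral
  let b := Module.finBasis k E
  let g : E := ⟨x, IntermediateField.mem_adjoin_simple_self k x⟩
  refine le_of_forall_pow_le_mul_pow (C := ∑ i, w (b i)) zero_le_one fun n ↦ ?_
  have h : x ^ n = ∑ i, algebraMap k A (b.repr (g ^ n) i) * b i := by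
    have := congrArg E.val (b.sum_repr (g ^ n))
    simpa [g, Algebra.smul_def] using this.symm
  rw [← map_pow, h, one_pow, mul_one]
  refine (w.sum_le _ _).trans (Finset.sum_le_sum fun i _ ↦ ?_)
  rw [map_mul]
  exact mul_le_of_le_one_left (w.nonneg _) (hw _)

theorem absoluteValue_algHom_apply_le {k A : Type*} [Field k] [Field A] [Algebra k A]
    [Algebra.IsAlgebraic k A] {v : AbsoluteValue k ℝ} {w : AbsoluteValue A ℝ}
    (hv : AbsComplete v) (hw : ExtendsAV v w (algebraMap k A)) (σ : A →ₐ[k] A) (x : A) :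
    w (σ x) ≤ w x := by
  by_cases hnt : ∃ c : k, 1 < v c
  · let _ : NontriviallyNormedField k :=
      { v.toNormedField with non_trivial := hnt }
    let _ : NormedField A := w.toNormedField
    let _ : NormedAlgebra k A :=
      { (inferInstance : Algebra k A) with
        norm_smul_le := fun c y ↦ by
          rw [Algebra.smul_def]
          exact ((w.map_mul _ _).trans (congrArg (· * w y) (hw c))).le }
    have : CompleteSpace k := by
      refine Metric.complete_of_cauchySeq_tendsto fun s hs ↦ ?_
      rw [Metric.cauchySeq_iff] at hs
      obtain ⟨a, ha⟩ := hv s fun ε hε ↦ by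
        obtain ⟨N, hN⟩ := hs ε hε
        exact ⟨N, fun m hm n hn ↦ (dist_eq_norm (s m) (s n)).symm.trans_lt (hN m hm n hn)⟩
      refine ⟨a, Metric.tendsto_atTop.2 fun ε hε ↦ ?_⟩
      obtain ⟨N, hN⟩ := ha ε hε
      exact ⟨N, fun n hn ↦ (dist_eq_norm (s n) a).trans_lt (hN n hn)⟩
    exact norm_algHom_apply_le σ x
  · push Not at hnt
    have hle : ∀ y : A, w y ≤ 1 :=
      absoluteValue_le_one_of_isAlgebraic (k := k) w fun c ↦ (hw c).le.trans (hnt c)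
    rcases eq_or_ne x 0 with rfl | hx
    · simp
    · have h := hle x⁻¹
      rw [map_inv₀] at h
      exact (hle _).trans ((inv_le_one₀ (w.pos hx)).1 h)

theorem absoluteValue_algEquiv_apply {k A : Type*} [Field k] [Field A] [Algebra k A]
    [Algebra.IsAlgebraic k A] {v : AbsoluteValue k ℝ} {w : AbsoluteValue A ℝ}
    (hv : AbsComplete v) (hw : ExtendsAV v w (algebraMap k A)) (τ : A ≃ₐ[k] A) (x : A) :
    w (τ x) = w x := by
  refine le_antisymm (absoluteValue_algHom_apply_le hv hw τ.toAlgHom x) ?_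
  simpa using absoluteValue_algHom_apply_le hv hw τ.symm.toAlgHom (τ x)

section Density

variable {M Mh F A : Type*} [Field M] [Field Mh] [Field F] [Field A]
  [Algebra M Mh] [Algebra M F] [Algebra Mh A] [Algebra M A] [IsScalarTower M Mh A]

open scoped TensorProduct

/-- Every element of `Mh ⊗ F` can be approximated by elements of `F`, simultaneously for two
`M`-embeddings of `F`. -/
theorem exists_approx_lift {v : AbsoluteValue Mh ℝ} {w : AbsoluteValue A ℝ}
    (hd : ∀ y : Mh, ∀ ε : ℝ, 0 < ε → ∃ x : M, v (y - algebraMap M Mh x) < ε)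
    (hw : ExtendsAV v w (algebraMap Mh A)) (α₁ α₂ : F →ₐ[M] A) (z : Mh ⊗[M] F) :
    ∀ ε : ℝ, 0 < ε → ∃ y : F,
      w (Algebra.TensorProduct.lift (Algebra.ofId Mh A) α₁ (fun _ _ ↦ .all _ _) z - α₁ y) < ε ∧
      w (Algebra.TensorProduct.lift (Algebra.ofId Mh A) α₂ (fun _ _ ↦ .all _ _) z - α₂ y) < ε := by
  induction z with
  | zero => exact fun ε hε ↦ ⟨0, by simpa using hε⟩
  | tmul c e =>
    intro ε hε
    let B := w (α₁ e) + w (α₂ e) + 1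
    have h₁ := w.nonneg (α₁ e)
    have h₂ := w.nonneg (α₂ e)
    have hB : 0 < B := by positivity
    obtain ⟨m, hm⟩ := hd c (ε / B) (div_pos hε hB)
    rw [lt_div_iff₀ hB] at hm
    have key (α : F →ₐ[M] A) (hα : w (α e) ≤ B) :
        w (Algebra.TensorProduct.lift (Algebra.ofId Mh A) α (fun _ _ ↦ .all _ _) (c ⊗ₜ e) -
          α (m • e)) < ε := by
      have : Algebra.TensorProduct.lift (Algebra.ofId Mh A) α (fun _ _ ↦ .all _ _) (c ⊗ₜ e) -
          α (m • e) = algebraMap Mh A (c - algebraMap M Mh m) * α e := by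
        simp [Algebra.ofId_apply, Algebra.smul_def, sub_mul, ← IsScalarTower.algebraMap_apply]
      rw [this, map_mul, hw]
      exact (mul_le_mul_of_nonneg_left hα (v.nonneg _)).trans_lt hm
    exact ⟨m • e, key α₁ (by linarith), key α₂ (by linarith)⟩
  | add a b ha hb =>
    intro ε hε
    obtain ⟨y, hy₁, hy₂⟩ := ha (ε / 2) (half_pos hε)
    obtain ⟨y', hy₁', hy₂'⟩ := hb (ε / 2) (half_pos hε)
    refine ⟨y + y', ?_, ?_⟩ <;> rw [map_add, map_add, add_sub_add_comm] <;>
      exact (w.add_le _ _).trans_lt (by linarith)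

theorem lift_eq_zero_of_lift_eq_zero {v : AbsoluteValue Mh ℝ} {w : AbsoluteValue A ℝ}
    (hd : ∀ y : Mh, ∀ ε : ℝ, 0 < ε → ∃ x : M, v (y - algebraMap M Mh x) < ε)
    (hw : ExtendsAV v w (algebraMap Mh A)) {α₁ α₂ : F →ₐ[M] A}
    (h : ∀ y, w (α₁ y) = w (α₂ y)) {z : Mh ⊗[M] F}
    (hz : Algebra.TensorProduct.lift (Algebra.ofId Mh A) α₁ (fun _ _ ↦ .all _ _) z = 0) :
    Algebra.TensorProduct.lift (Algebra.ofId Mh A) α₂ (fun _ _ ↦ .all _ _) z = 0 := by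
  refine w.eq_zero.1 (le_antisymm (le_of_forall_pos_le_add fun ε hε ↦ ?_) (w.nonneg _))
  obtain ⟨y, hy₁, hy₂⟩ := exists_approx_lift hd hw α₁ α₂ z (ε / 2) (half_pos hε)
  rw [hz, zero_sub, w.map_neg, h] at hy₁
  have := w.add_le (Algebra.TensorProduct.lift (Algebra.ofId Mh A) α₂ (fun _ _ ↦ .all _ _) z -
    α₂ y) (α₂ y)
  rw [sub_add_cancel] at this
  linarith

end Density

/-- Two algebra homomorphisms to a normal extension whose kernels are nested differ by an
automorphism. -/
theorem exists_algEquiv_of_ker_le {k R A : Type*} [Field k] [CommRing R] [Field A]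
    [Algebra k R] [Algebra k A] [Normal k A] (φ₁ φ₂ : R →ₐ[k] A)
    (h : ∀ z, φ₁ z = 0 → φ₂ z = 0) : ∃ τ : A ≃ₐ[k] A, ∀ z, φ₂ z = τ (φ₁ z) := by
  let E : IntermediateField k A :=
    Subalgebra.toIntermediateField' φ₁.range
      (Subalgebra.isField_of_algebraic φ₁.range)
  let π : R →ₐ[k] E := φ₁.rangeRestrict
  have hπ : Function.Surjective π := φ₁.rangeRestrict_surjective
  have hval (z : R) : algebraMap E A (π z) = φ₁ z := rfl
  let e := Ideal.quotientKerAlgEquivOfSurjective hπ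
  have hker (z : R) (hz : z ∈ RingHom.ker π) : φ₂ z = 0 :=
    h z (by rw [← hval, (RingHom.mem_ker).1 hz, map_zero])
  let σ : E →ₐ[k] A := (Ideal.Quotient.liftₐ (RingHom.ker π) φ₂ hker).comp e.symm.toAlgHom
  have hσ (z : R) : σ (π z) = φ₂ z := by
    have : e.symm (π z) = Ideal.Quotient.mk _ z := by
      rw [AlgEquiv.symm_apply_eq]
      rfl
    exact congrArg (Ideal.Quotient.liftₐ (RingHom.ker π) φ₂ hker) this
  let τ : A →ₐ[k] A := σ.liftNormal A
  refine ⟨AlgEquiv.ofBijective τ (Algebra.IsAlgebraic.algHom_bijective τ), fun z ↦ ?_⟩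
  have := σ.liftNormal_commutes A (π z)
  rw [hval, hσ] at this
  exact this.symm

/-- **Lemma (fibers of Φ).**
In the setting of the local theorem, with `vMa` the (unique) absolute value on `M̂ᵃ`
extending that of `M̂`:  two embeddings `α₁, α₂ ∈ ℰ` induce the same absolute value on `F`
(by pulling back `vMa`) if and only if `α₂ = τ ∘ α₁` for some `M̂`-algebra automorphism `τ`
of `M̂ᵃ`. -/
theorem local_Phi_fibers
    {K L M F : Type*} [Field K] [Field L] [Field M] [Field F]
    [Algebra K L] [Algebra K M] [Algebra K F] [Algebra L F] [Algebra M F]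
    [IsScalarTower K L F] [IsScalarTower K M F]
    [FiniteDimensional K L] [FiniteDimensional M F]
    (vK : AbsoluteValue K ℝ) (vL : AbsoluteValue L ℝ) (vM : AbsoluteValue M ℝ)
    (hvL : ExtendsAV vK vL (algebraMap K L)) (hvM : ExtendsAV vK vM (algebraMap K M))
    -- the completions `K̂`, `L̂`, `M̂`
    {Kh Lh Mh : Type*} [Field Kh] [Field Lh] [Field Mh]
    [Algebra K Kh] [Algebra L Lh] [Algebra M Mh]
    [Algebra Kh Lh] [Algebra Kh Mh] [Algebra K Lh] [Algebra K Mh]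
    [IsScalarTower K Kh Lh] [IsScalarTower K L Lh]
    [IsScalarTower K Kh Mh] [IsScalarTower K M Mh]
    (vKh : AbsoluteValue Kh ℝ) (vLh : AbsoluteValue Lh ℝ) (vMh : AbsoluteValue Mh ℝ)
    (hKh : IsCompletion vK vKh (algebraMap K Kh))
    (hLh : IsCompletion vL vLh (algebraMap L Lh))
    (hMh : IsCompletion vM vMh (algebraMap M Mh))
    (hKhLh : ExtendsAV vKh vLh (algebraMap Kh Lh))
    (hKhMh : ExtendsAV vKh vMh (algebraMap Kh Mh))
    -- an algebraic closure `M̂ᵃ` of `M̂`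
    {Ma : Type*} [Field Ma] [Algebra Mh Ma] [IsAlgClosure Mh Ma]
    [Algebra Kh Ma] [IsScalarTower Kh Mh Ma]
    [Algebra M Ma] [IsScalarTower M Mh Ma]
    (vMa : AbsoluteValue Ma ℝ) (hvMa : ExtendsAV vMh vMa (algebraMap Mh Ma)) :
    ∀ α₁ α₂ : F →ₐ[M] Ma,
      (∃ γ : Lh →ₐ[Kh] Ma, ∀ x : L, α₁ (algebraMap L F x) = γ (algebraMap L Lh x)) →
      (∃ γ : Lh →ₐ[Kh] Ma, ∀ x : L, α₂ (algebraMap L F x) = γ (algebraMap L Lh x)) →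
      ((∀ y : F, vMa (α₁ y) = vMa (α₂ y)) ↔
        ∃ τ : Ma ≃ₐ[Mh] Ma, ∀ y : F, α₂ y = τ (α₁ y)) := by
  intro α₁ α₂ _ _
  have : Algebra.IsAlgebraic Mh Ma := IsAlgClosure.isAlgebraic
  have : IsAlgClosed Ma := IsAlgClosure.isAlgClosed Mh
  constructor
  · intro h
    have : Normal Mh Ma := IsAlgClosure.normal Mh Ma
    obtain ⟨τ, hτ⟩ := exists_algEquiv_of_ker_le _ _ fun z ↦
      lift_eq_zero_of_lift_eq_zero hMh.dense hvMa h (z := z)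
    exact ⟨τ, fun y ↦ by simpa using hτ (Algebra.TensorProduct.includeRight y)⟩
  · rintro ⟨τ, hτ⟩ y
    rw [hτ, absoluteValue_algEquiv_apply hMh.complete hvMa]
end
end
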